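/- Let Σ₁ be a bounded causal output strictly passive system with constant ε > 0 (i.e. ⟨u, Σ₁(u)⟩ ≥ ε‖Σ₁(u)‖₂² for all u ∈ L2), and let Σ₂ be a bounded causal passive system. Then for any L2 signals satisfying the feedback equations with e₂ = 0, namely u₁ = e₁ − y₂, u₂ = y₁, y₁ = Σ₁(u₁), y₂ = Σ₂(u₂), one has ⟨e₁, y₁⟩ ≥ ε‖y₁‖₂², i.e. the closed-loop map from e₁ to y₁ is ε-output strictly passive; consequently ‖y₁‖₂ ≤ (1/ε)‖e₁‖₂, so the closed loop has L2-gain at most 1/ε from e₁ to y₁. -/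

import Mathlib

open MeasureTheory Set

noncomputable section

/-- Signals: functions from time `[0,∞)` (modeled as `ℝ`, with everything measured on `Ioi 0`)
to `ℝⁿ`. -/
abbrev Signal (n : ℕ) : Type := ℝ → Fin n → ℝ

/-- Membership in `L₂`: square integrability on `[0,∞)`. -/
def memL2 {n : ℕ} (v : Signal n) : Prop :=
  MemLp v 2 (volume.restrict (Ioi (0:ℝ)))

/-- The `L₂` inner product `⟨v,w⟩ = ∫₀^∞ v(t)ᵀ w(t) dt`. -/
def ip {n : ℕ} (v w : Signal n) : ℝ :=
  ∫ t in Ioi (0:ℝ), ∑ i, v t i * w t i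

/-- Squared `L₂`-norm `‖v‖₂²`. -/
def normSq {n : ℕ} (v : Signal n) : ℝ := ip v v

/-- The `L₂`-norm `‖v‖₂`. -/
def l2norm {n : ℕ} (v : Signal n) : ℝ := Real.sqrt (normSq v)

/-- Truncation operator `P_T`. -/
def trunc {n : ℕ} (T : ℝ) (v : Signal n) : Signal n :=
  fun t => if t ≤ T then v t else 0

/-- Right-shift operator `S_τ`. -/
def rshift {n : ℕ} (τ : ℝ) (v : Signal n) : Signal n :=
  fun t => if τ ≤ t then v (t - τ) else 0

/-- Membership in the extended space `L₂ₑ`: every truncation is in `L₂`. -/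
def memL2e {n : ℕ} (v : Signal n) : Prop := ∀ T : ℝ, memL2 (trunc T v)

/-- A system is an input-output map with `Σ(0) = 0`. -/
def IsSystem {n : ℕ} (F : Signal n → Signal n) : Prop := F 0 = 0

/-- Causality: `P_T Σ P_T = P_T Σ` for all `T ≥ 0`. -/
def IsCausal {n : ℕ} (F : Signal n → Signal n) : Prop :=
  ∀ T ≥ (0:ℝ), ∀ u : Signal n, trunc T (F (trunc T u)) = trunc T (F u)

/-- Boundedness: `F` maps `L₂` into `L₂`. -/
def IsBoundedSys {n : ℕ} (F : Signal n → Signal n) : Prop :=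
  ∀ u : Signal n, memL2 u → memL2 (F u)

/-- Linearity of an input-output map. -/
def IsLinearSys {n : ℕ} (F : Signal n → Signal n) : Prop :=
  ∀ (c : ℝ) (u v : Signal n), F (c • u + v) = c • F u + F v

/-- Time invariance: `F` commutes with all right shifts. -/
def TimeInvariant {n : ℕ} (F : Signal n → Signal n) : Prop :=
  ∀ τ ≥ (0:ℝ), ∀ u : Signal n, F (rshift τ u) = rshift τ (F u)

/-- Passivity for a general (not necessarily bounded) system:
`∫₀ᵀ u(t)ᵀ (F u)(t) dt ≥ 0` for all `u ∈ L₂ₑ` and `T > 0`. -/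
def PassiveTrunc {n : ℕ} (F : Signal n → Signal n) : Prop :=
  ∀ u : Signal n, memL2e u → ∀ T > (0:ℝ), 0 ≤ ip (trunc T u) (trunc T (F u))

/-- Passivity for a bounded causal system: `⟨u, F u⟩ ≥ 0` for all `u ∈ L₂`. -/
def PassiveL2 {n : ℕ} (F : Signal n → Signal n) : Prop :=
  ∀ u : Signal n, memL2 u → 0 ≤ ip u (F u)

/-- Strict passivity for a bounded causal system. -/
def StrictlyPassive {n : ℕ} (F : Signal n → Signal n) : Prop :=
  ∃ δ > (0:ℝ), ∃ ε > (0:ℝ), ∀ u : Signal n, memL2 u →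
    δ * normSq u + ε * normSq (F u) ≤ ip u (F u)

/-- Output strict passivity for a bounded causal system. -/
def OutputStrictlyPassive {n : ℕ} (F : Signal n → Signal n) : Prop :=
  ∃ ε > (0:ℝ), ∀ u : Signal n, memL2 u →
    ε * normSq (F u) ≤ ip u (F u)

/-- `F` has `L₂`-gain `≤ γ`. -/
def HasGainLe {n : ℕ} (γ : ℝ) (F : Signal n → Signal n) : Prop :=
  ∀ u : Signal n, memL2e u → ∀ T ≥ (0:ℝ),
    l2norm (trunc T (F u)) ≤ γ * l2norm (trunc T u)

end

lemma ip_integrable {n : ℕ} {v w : Signal n} (hv : memL2 v) (hw : memL2 w) :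
    Integrable (fun t => ∑ i, v t i * w t i) (volume.restrict (Ioi (0:ℝ))) := by
  refine integrable_finsetSum _ fun i _ => ?_
  have h1 : MemLp (fun t => v t i) 2 (volume.restrict (Ioi (0:ℝ))) := hv.eval i
  have h2 : MemLp (fun t => w t i) 2 (volume.restrict (Ioi (0:ℝ))) := hw.eval i
  exact h1.integrable_mul h2

lemma ip_expand {n : ℕ} {e y : Signal n} (c : ℝ) (he : memL2 e) (hy : memL2 y) :
    0 ≤ normSq e - 2 * c * ip e y + c ^ 2 * normSq y := by
  have h : normSq e - 2 * c * ip e y + c ^ 2 * normSq y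
      = ∫ t in Ioi (0:ℝ), ∑ i, (e t i - c * y t i) ^ 2 := by
    have hI : Integrable (fun t => ∑ i, e t i * e t i - 2 * c * ∑ i, e t i * y t i)
        (volume.restrict (Ioi (0:ℝ))) :=
      (ip_integrable he he).sub ((ip_integrable he hy).const_mul _)
    unfold normSq ip
    rw [← integral_const_mul, ← integral_const_mul, ← integral_sub (ip_integrable he he)
      ((ip_integrable he hy).const_mul _), ← integral_add hI
      ((ip_integrable hy hy).const_mul _)]
    congr 1
    ext t
    rw [Finset.mul_sum, Finset.mul_sum, ← Finset.sum_sub_distrib, ← Finset.sum_add_distrib]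
    exact Finset.sum_congr rfl fun i _ => by ring
  rw [h]
  exact integral_nonneg fun t => Finset.sum_nonneg fun i _ => sq_nonneg _

lemma ip_sub_eq {n : ℕ} {e z y : Signal n} (he : memL2 e) (hz : memL2 z) (hy : memL2 y) :
    ip (e - z) y = ip e y - ip y z := by
  unfold ip
  rw [← integral_sub (ip_integrable he hy) (ip_integrable hy hz)]
  congr 1
  ext t
  rw [← Finset.sum_sub_distrib]
  exact Finset.sum_congr rfl fun i _ => by simp only [Pi.sub_apply]; ring

/-- Quantitative sufficiency part of **Theorem 3**: if `Sig1` is output strictly passive with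
constant `ε > 0` and `Sig2` is passive, then the closed loop (with `e₂ = 0`) is `ε`-output
strictly passive from `e₁` to `y₁`, and consequently has `L₂`-gain at most `1/ε`. -/
theorem passivity_sufficiency_e2_zero {n : ℕ} (Sig1 Sig2 : Signal n → Signal n)
    (ε : ℝ) (hε : 0 < ε)
    (hSig1sys : IsSystem Sig1) (hSig1b : IsBoundedSys Sig1) (hSig1c : IsCausal Sig1)
    (hSig1osp : ∀ u : Signal n, memL2 u → ε * normSq (Sig1 u) ≤ ip u (Sig1 u))
    (hSig2sys : IsSystem Sig2) (hSig2b : IsBoundedSys Sig2) (hSig2c : IsCausal Sig2)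
    (hSig2p : PassiveL2 Sig2)
    (e₁ u₁ u₂ y₁ y₂ : Signal n)
    (he₁ : memL2 e₁) (hu₁ : memL2 u₁) (hu₂ : memL2 u₂) (hy₁ : memL2 y₁) (hy₂ : memL2 y₂)
    (hfb₁ : u₁ = e₁ - y₂) (hfb₂ : u₂ = y₁) (hout₁ : y₁ = Sig1 u₁) (hout₂ : y₂ = Sig2 u₂) :
    ε * normSq y₁ ≤ ip e₁ y₁ ∧ l2norm y₁ ≤ (1 / ε) * l2norm e₁ := by
  have h1 := hSig1osp u₁ hu₁
  have h2 := hSig2p u₂ hu₂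
  rw [← hout₁, hfb₁, ip_sub_eq he₁ hy₂ hy₁] at h1
  rw [← hout₂, hfb₂] at h2
  have h3 : ε * normSq y₁ ≤ ip e₁ y₁ := by linarith
  refine ⟨h3, ?_⟩
  have h4 := ip_expand ε he₁ hy₁
  have h5 : ε ^ 2 * normSq y₁ ≤ normSq e₁ := by nlinarith
  rw [one_div, ← div_eq_inv_mul, le_div_iff₀ hε]
  unfold l2norm
  have h6 := Real.sqrt_le_sqrt h5
  rwa [Real.sqrt_mul (sq_nonneg ε), Real.sqrt_sq hε.le, mul_comm] at h6
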